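/- For every r > 2 there is a constant C depending only on r such that the following holds for all ε ∈ (0,1], t ∈ [0,ε], τ > 0. Let w̄ = (w̄_ξ)_{ξ∈ℝ} be a family of twice continuously differentiable functions w̄_ξ : [0,∞) → ℂ with w̄_ξ(0) = 0, and A = (A_ξ)_{ξ∈ℝ} ⊂ ℂ, for which all norms below are finite and all integrals converge absolutely. Define ∂_yℒ_ξ(y) = i∫_ℝ ( ∂_y w̄_η(y)(ξ−η)A_{ξ−η}θ_{ξ−η}(y) + w̄_η(y)(ξ−η)A_{ξ−η}∂_yθ_{ξ−η}(y) + A_ηθ_η(y)(ξ−η)∂_y w̄_{ξ−η}(y) − η I_y[w̄_η] A_{ξ−η} ∂_{yy}θ_{ξ−η}(y) ) dη and T_{∂yℒ} = ∫_ℝ∫_0^∞ ∂_yℒ_ξ(y) conj(∂_y w̄_ξ(y)) χ(y)² ρ(y)² e^{2τ|ξ|} ⟨ξ⟩^{2r−1} dy dξ. Then |T_{∂yℒ}| ≤ C ( ‖χ∂_y w̄‖²_{τ,r−1/2} ‖|∂ₓ|^{1/2} A‖~_{τ,r} + ‖χ∂_y w̄‖_{τ,r−1/2} ‖⟨∂ₓ⟩^{1/2}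 w̄‖_{τ,r} ‖A‖~_{τ,r} + ‖χ|∂ₓ|^{1/2}∂_y w̄‖_{τ,r−1/2} ‖χ⟨∂ₓ⟩^{1/2}∂_y w̄‖_{τ,r−1/2} ‖A‖~_{τ,r} ). -/

import Mathlib

open MeasureTheory Set Filter

noncomputable section

/-- Gaussian weight `ρ(y) = exp(y²/(8(1+t/ε)))`. -/
def rho (ε t y : ℝ) : ℝ := Real.exp (y ^ 2 / (8 * (1 + t / ε)))

/-- Japanese bracket `⟨ξ⟩ = √(1+ξ²)`. -/
def brak (ξ : ℝ) : ℝ := Real.sqrt (1 + ξ ^ 2)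

/-- Combined weight `ρ(y)² e^{2τ|ξ|} ⟨ξ⟩^{2s}` in the squared analytic norms. -/
def wgt (ε t τ s ξ y : ℝ) : ℝ :=
  (rho ε t y) ^ 2 * Real.exp (2 * τ * |ξ|) * brak ξ ^ (2 * s)

/-- Weight `e^{2τ|ξ|} ⟨ξ⟩^{2s}` for the squared analytic norms of boundary data. -/
def aWgt (τ s ξ : ℝ) : ℝ := Real.exp (2 * τ * |ξ|) * brak ξ ^ (2 * s)

/-- Analytic norm `‖w‖_{τ,s}` (with Fourier multiplier `m`):
`(∫_ℝ ∫_0^∞ m(ξ) ρ(y)² |w_ξ(y)|² e^{2τ|ξ|} ⟨ξ⟩^{2s} dy dξ)^{1/2}`. -/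
def wNorm (ε t τ s : ℝ) (m : ℝ → ℝ) (w : ℝ → ℝ → ℂ) : ℝ :=
  Real.sqrt (∫ ξ : ℝ, ∫ y in Ioi (0 : ℝ), m ξ * ‖w ξ y‖ ^ 2 * wgt ε t τ s ξ y)

/-- Analytic norm `‖A‖~_{τ,s}` (with Fourier multiplier `m`):
`(∫_ℝ m(ξ) |A_ξ|² e^{2τ|ξ|} ⟨ξ⟩^{2s} dξ)^{1/2}`. -/
def aNorm (τ s : ℝ) (m : ℝ → ℝ) (A : ℝ → ℂ) : ℝ :=
  Real.sqrt (∫ ξ : ℝ, m ξ * ‖A ξ‖ ^ 2 * aWgt τ s ξ)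

/-- Finiteness of the squared norm `‖·‖_{τ,s}` with multiplier `m`. -/
def wFinite (ε t τ s : ℝ) (m : ℝ → ℝ) (w : ℝ → ℝ → ℂ) : Prop :=
  Integrable (fun p : ℝ × ℝ => m p.1 * ‖w p.1 p.2‖ ^ 2 * wgt ε t τ s p.1 p.2)
    ((volume : Measure ℝ).prod ((volume : Measure ℝ).restrict (Ioi 0)))

/-- Finiteness of the squared norm `‖·‖~_{τ,s}` with multiplier `m`. -/
def aFinite (τ s : ℝ) (m : ℝ → ℝ) (A : ℝ → ℂ) : Prop :=
  Integrable (fun ξ : ℝ => m ξ * ‖A ξ‖ ^ 2 * aWgt τ s ξ) (volume : Measure ℝ)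

/-- Lift function `θ_ξ(y) = 1 − exp(−y²⟨ξ⟩²/(2(1+t/ε)))`. -/
def theta (ε t ξ y : ℝ) : ℝ :=
  1 - Real.exp (-(y ^ 2 * (1 + ξ ^ 2)) / (2 * (1 + t / ε)))

/-- `I_y[h] = ∫_0^y h`. -/
def Iy (h : ℝ → ℂ) (y : ℝ) : ℂ := ∫ y' in (0 : ℝ)..y, h y'

/-- The differentiated linear term `∂_yℒ_ξ(w̄,A)(y)`. -/
def dyLcal (ε t : ℝ) (w : ℝ → ℝ → ℂ) (A : ℝ → ℂ) (ξ y : ℝ) : ℂ :=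
  Complex.I * ∫ η : ℝ,
    (deriv (w η) y * ((ξ - η : ℝ) : ℂ) * A (ξ - η) * ((theta ε t (ξ - η) y : ℝ) : ℂ)
      + w η y * ((ξ - η : ℝ) : ℂ) * A (ξ - η) * ((deriv (theta ε t (ξ - η)) y : ℝ) : ℂ)
      + A η * ((theta ε t η y : ℝ) : ℂ) * ((ξ - η : ℝ) : ℂ) * deriv (w (ξ - η)) y
      - (η : ℂ) * Iy (w η) y * A (ξ - η) *
          ((deriv (deriv (theta ε t (ξ - η))) y : ℝ) : ℂ))

open scoped ENNReal

/-- square-root of the lower integral of the square -/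
def nn {α : Type*} [MeasurableSpace α] (μ : Measure α) (f : α → ℝ≥0∞) : ℝ≥0∞ :=
  (∫⁻ x, f x ^ 2 ∂μ) ^ (1 / 2 : ℝ)

lemma nn_sq {α : Type*} [MeasurableSpace α] (μ : Measure α) (f : α → ℝ≥0∞) :
    nn μ f ^ 2 = ∫⁻ x, f x ^ 2 ∂μ := by
  unfold nn
  rw [← ENNReal.rpow_two, ← ENNReal.rpow_mul]; norm_num

lemma nn_eq_of_sq {α : Type*} [MeasurableSpace α] {μ : Measure α} {f : α → ℝ≥0∞} {c : ℝ≥0∞}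
    (h : ∫⁻ x, f x ^ 2 ∂μ = c ^ 2) : nn μ f = c := by
  unfold nn
  rw [h, ← ENNReal.rpow_two, ← ENNReal.rpow_mul]; norm_num

lemma nn_CS {α : Type*} [MeasurableSpace α] (μ : Measure α) {f g : α → ℝ≥0∞}
    (hf : AEMeasurable f μ) (hg : AEMeasurable g μ) :
    ∫⁻ x, f x * g x ∂μ ≤ nn μ f * nn μ g := by
  have := ENNReal.lintegral_mul_le_Lp_mul_Lq μ Real.HolderConjugate.two_two hf hg
  simpa [nn] using this

/-- the decaying weight -/
def DD (x : ℝ) : ℝ≥0∞ := ENNReal.ofReal (brak x)⁻¹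

lemma measurable_brak : Measurable brak := by unfold brak; fun_prop

lemma measurable_DD : Measurable DD := by
  unfold DD; exact measurable_brak.inv.ennreal_ofReal

lemma brak_pos (x : ℝ) : 0 < brak x := by unfold brak; positivity

lemma brak_sq (x : ℝ) : brak x ^ 2 = 1 + x ^ 2 := Real.sq_sqrt (by positivity)

lemma lint_DD : ∫⁻ x, DD x ^ 2 = ENNReal.ofReal (Real.pi) := by
  have : ∀ x, DD x ^ 2 = ENNReal.ofReal ((1 + x ^ 2)⁻¹) := by
    intro x
    unfold DD
    rw [← ENNReal.ofReal_pow (inv_nonneg.2 (brak_pos x).le), inv_pow, brak_sq]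
  simp_rw [this]
  rw [← ofReal_integral_eq_lintegral_ofReal integrable_inv_one_add_sq
    (Eventually.of_forall fun x => by positivity), integral_univ_inv_one_add_sq]

lemma nn_DD : nn volume DD ≤ 2 := by
  unfold nn
  rw [lint_DD]
  calc (ENNReal.ofReal Real.pi) ^ (1 / 2 : ℝ) ≤ (ENNReal.ofReal 4) ^ (1 / 2 : ℝ) := by
        gcongr; exact Real.pi_le_four
    _ = 2 := by
        rw [show (4 : ℝ) = 2 ^ 2 by norm_num, ENNReal.ofReal_pow (by norm_num),
          ← ENNReal.rpow_two, ← ENNReal.rpow_mul]; norm_num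

lemma nn_sub_right (f : ℝ → ℝ≥0∞) (a : ℝ) : nn volume (fun x => f (x - a)) = nn volume f := by
  unfold nn
  rw [lintegral_sub_right_eq_self (fun x => f x ^ 2) a]

lemma L1' {P Q R : ℝ → ℝ≥0∞} (hP : Measurable P) (hQ : Measurable Q) (hR : Measurable R) :
    ∫⁻ x, ∫⁻ y, P x * Q y * R (x - y) ≤ nn volume P * (∫⁻ y, Q y) * nn volume R := by
  rw [lintegral_lintegral_swap (by fun_prop)]
  calc ∫⁻ y, ∫⁻ x, P x * Q y * R (x - y)
      = ∫⁻ y, Q y * ∫⁻ x, P x * R (x - y) := by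
        congr 1; ext y
        rw [← lintegral_const_mul _ (by fun_prop)]
        congr 1; ext x; ring
    _ ≤ ∫⁻ y, Q y * (nn volume P * nn volume R) := by
        gcongr with y
        refine (nn_CS volume (by fun_prop) (by fun_prop)).trans ?_
        rw [nn_sub_right]
    _ = _ := by
        rw [lintegral_mul_const _ hQ]; ring

lemma L1 {P Q R : ℝ → ℝ≥0∞} (hP : Measurable P) (hQ : Measurable Q) (hR : Measurable R) :
    ∫⁻ x, ∫⁻ y, P x * Q y * R (x - y) ≤ nn volume P * nn volume Q * ∫⁻ y, R y := by
  have := L1' hP hR hQ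
  calc _ = ∫⁻ x, ∫⁻ y, P x * R y * Q (x - y) := by
        congr 1; ext x
        rw [← lintegral_sub_left_eq_self _ x]
        congr 1; ext y
        rw [sub_sub_cancel]; ring
    _ ≤ _ := this
    _ = _ := by ring

lemma L2 {P Q R : ℝ → ℝ≥0∞} (hP : Measurable P) (hQ : Measurable Q) (hR : Measurable R) :
    ∫⁻ x, ∫⁻ y, P x * Q y * R (x - y) * (DD (x - y) + DD y) ≤
      4 * (nn volume P * nn volume Q * nn volume R) := by
  have hD := measurable_DD
  have h1 : ∀ F : ℝ → ℝ≥0∞, Measurable F → ∫⁻ y, F y * DD y ≤ nn volume F * 2 := fun F hF =>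
    (nn_CS volume hF.aemeasurable hD.aemeasurable).trans (by gcongr; exact nn_DD)
  calc _ = ∫⁻ x, ∫⁻ y, (P x * Q y * (fun z => R z * DD z) (x - y)
            + P x * (fun z => Q z * DD z) y * R (x - y)) := by
        congr 1; ext x; congr 1; ext y; ring
    _ = (∫⁻ x, ∫⁻ y, P x * Q y * (fun z => R z * DD z) (x - y))
          + ∫⁻ x, ∫⁻ y, P x * (fun z => Q z * DD z) y * R (x - y) := by
        rw [← lintegral_add_left]
        · congr 1; ext x
          rw [lintegral_add_left (by fun_prop)]
        · apply Measurable.lintegral_prod_right'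
            (f := fun p : ℝ × ℝ => P p.1 * Q p.2 * (fun z => R z * DD z) (p.1 - p.2))
          fun_prop
    _ ≤ nn volume P * nn volume Q * (nn volume R * 2)
          + nn volume P * (nn volume Q * 2) * nn volume R := by
        gcongr
        · exact (L1 hP hQ (hR.mul hD)).trans (by gcongr; exact h1 R hR)
        · exact (L1' hP (hQ.mul hD) hR).trans (by gcongr; exact h1 Q hQ)
    _ = _ := by ring

/-- two-variable norm -/
def n2 (ν : Measure ℝ) (u : ℝ × ℝ → ℝ≥0∞) : ℝ≥0∞ :=
  nn volume (fun x => nn ν (fun y => u (x, y)))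

lemma meas_nn {ν : Measure ℝ} [SFinite ν] {u : ℝ × ℝ → ℝ≥0∞} (hu : Measurable u) :
    Measurable (fun x => nn ν (fun y => u (x, y))) := by
  unfold nn
  have : Measurable fun x => ∫⁻ y, u (x, y) ^ 2 ∂ν :=
    Measurable.lintegral_prod_right' (f := fun p : ℝ × ℝ => u p ^ 2) (by fun_prop)
  exact this.pow_const _

lemma L3 {ν : Measure ℝ} [SFinite ν] {u v : ℝ × ℝ → ℝ≥0∞} {b : ℝ → ℝ≥0∞} (hu : Measurable u)
    (hv : Measurable v) (hb : Measurable b) :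
    ∫⁻ x, (∫⁻ y, (∫⁻ z, u (x, y) * v (z, y) * b (x - z) * (DD (x - z) + DD z)) ∂ν) ≤
      4 * (n2 ν u * n2 ν v * nn volume b) := by
  have hD := measurable_DD
  refine le_trans ?_ (L2 (meas_nn hu) (meas_nn hv) hb)
  refine lintegral_mono fun x => ?_
  rw [lintegral_lintegral_swap (by fun_prop)]
  refine lintegral_mono fun z => ?_
  calc ∫⁻ y, u (x, y) * v (z, y) * b (x - z) * (DD (x - z) + DD z) ∂ν
      = (∫⁻ y, u (x, y) * v (z, y) ∂ν) * (b (x - z) * (DD (x - z) + DD z)) := by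
        rw [← lintegral_mul_const _ (by fun_prop)]
        congr 1; ext y; ring
    _ ≤ (nn ν (fun y => u (x, y)) * nn ν (fun y => v (z, y))) *
          (b (x - z) * (DD (x - z) + DD z)) := by
        gcongr
        exact nn_CS ν (by fun_prop) (by fun_prop)
    _ = _ := by ring

lemma L3' {ν : Measure ℝ} [SFinite ν] {u v : ℝ × ℝ → ℝ≥0∞} {b : ℝ → ℝ≥0∞} (hu : Measurable u)
    (hv : Measurable v) (hb : Measurable b) :
    ∫⁻ x, (∫⁻ y, (∫⁻ z, u (x, y) * v (x - z, y) * b z * (DD z + DD (x - z))) ∂ν) ≤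
      4 * (n2 ν u * n2 ν v * nn volume b) := by
  refine le_trans (le_of_eq ?_) (L3 hu hv hb)
  congr 1; ext x; congr 1; ext y
  rw [← lintegral_sub_left_eq_self _ x]
  simp only [sub_sub_cancel]

lemma one_le_brak (x : ℝ) : 1 ≤ brak x := by
  unfold brak; rw [Real.one_le_sqrt]; nlinarith [sq_nonneg x]

lemma abs_le_brak (x : ℝ) : |x| ≤ brak x := by
  unfold brak; apply Real.abs_le_sqrt; linarith

lemma brak_sub (x : ℝ) : brak (-x) = brak x := by unfold brak; simp

lemma brak_add_le (x y : ℝ) : brak (x + y) ≤ 2 * brak x * brak y := by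
  have h1 := brak_sq x
  have h2 := brak_sq y
  have h3 := brak_sq (x + y)
  have p1 := brak_pos x
  have p2 := brak_pos y
  refine abs_le_of_sq_le_sq' ?_ (by positivity) |>.2
  rw [h3, mul_pow, mul_pow, h1, h2]
  nlinarith [sq_nonneg (x - y), sq_nonneg (x * y), sq_nonneg x, sq_nonneg y]

lemma brak_add_le' (x y : ℝ) : brak (x + y) ≤ 2 * max (brak x) (brak y) := by
  have key : ∀ x y : ℝ, |x| ≤ |y| → brak (x + y) ≤ 2 * brak y := by
    intro x y h
    have h2 := brak_sq y
    have h3 := brak_sq (x + y)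
    have p2 := brak_pos y
    refine abs_le_of_sq_le_sq' ?_ (by positivity) |>.2
    rw [h3, mul_pow, h2]
    have := sq_le_sq.2 h
    nlinarith [sq_nonneg (x - y)]
  rcases le_total |x| |y| with h | h
  · exact (key x y h).trans (by gcongr; exact le_max_right _ _)
  · rw [add_comm]
    exact (key y x h).trans (by gcongr; exact le_max_left _ _)

lemma brak_rpow_add {s : ℝ} (hs : 0 ≤ s) (x y : ℝ) :
    brak (x + y) ^ s ≤ 2 ^ s * (brak x ^ s + brak y ^ s) := by
  have p1 := brak_pos x
  have p2 := brak_pos y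
  calc brak (x + y) ^ s ≤ (2 * max (brak x) (brak y)) ^ s :=
        Real.rpow_le_rpow (brak_pos _).le (brak_add_le' x y) hs
    _ = 2 ^ s * (max (brak x) (brak y)) ^ s :=
        Real.mul_rpow (by norm_num) (le_max_of_le_left p1.le)
    _ ≤ _ := by
        gcongr
        rcases le_total (brak x) (brak y) with h | h
        · rw [max_eq_right h]; linarith [Real.rpow_nonneg p1.le s]
        · rw [max_eq_left h]; linarith [Real.rpow_nonneg p2.le s]

lemma brak_rpow_mul {s : ℝ} (hs : 0 ≤ s) (x y : ℝ) :
    brak (x + y) ^ s ≤ 2 ^ s * (brak x ^ s * brak y ^ s) := by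
  have p1 := brak_pos x
  have p2 := brak_pos y
  calc brak (x + y) ^ s ≤ (2 * brak x * brak y) ^ s :=
        Real.rpow_le_rpow (brak_pos _).le (brak_add_le x y) hs
    _ = _ := by
        rw [Real.mul_rpow (by positivity) p2.le, Real.mul_rpow (by positivity) p1.le]; ring

lemma abs_le_sqrt_mul (z : ℝ) : |z| ≤ √|z| * brak z ^ (1 / 2 : ℝ) := by
  rw [← Real.sqrt_eq_rpow]
  calc |z| = √|z| * √|z| := (Real.mul_self_sqrt (abs_nonneg z)).symm
    _ ≤ _ := by gcongr; exact abs_le_brak z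

lemma P1 {r : ℝ} (hr : 2 < r) (η ζ : ℝ) :
    brak (η + ζ) ^ (r - 1 / 2) * |ζ| ≤ 2 ^ (r - 1 / 2) *
      (brak η ^ (r - 1 / 2) * brak ζ ^ r * √|ζ| * ((brak ζ)⁻¹ + (brak η)⁻¹)) := by
  have p1 := brak_pos η
  have p2 := brak_pos ζ
  have e1 : brak η ^ (r - 1 / 2) * brak ζ ^ (1 / 2 : ℝ) ≤
      brak η ^ (r - 1 / 2) * brak ζ ^ r * (brak ζ)⁻¹ := by
    rw [mul_assoc, ← Real.rpow_neg_one (brak ζ), ← Real.rpow_add p2]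
    gcongr
    · exact one_le_brak ζ
    · linarith
  have e2 : brak ζ ^ (r - 1 / 2) * brak ζ ^ (1 / 2 : ℝ) ≤
      brak η ^ (r - 1 / 2) * brak ζ ^ r * (brak η)⁻¹ := by
    rw [← Real.rpow_add p2, mul_right_comm, ← Real.rpow_neg_one (brak η), ← Real.rpow_add p1]
    rw [show r - 1 / 2 + 1 / 2 = r by ring]
    apply le_mul_of_one_le_left (by positivity)
    exact Real.one_le_rpow (one_le_brak η) (by linarith)
  calc _ ≤ (2 ^ (r - 1 / 2) * (brak η ^ (r - 1 / 2) + brak ζ ^ (r - 1 / 2))) *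
        (√|ζ| * brak ζ ^ (1 / 2 : ℝ)) := by
        gcongr
        · exact brak_rpow_add (by linarith) η ζ
        · exact abs_le_sqrt_mul ζ
    _ = 2 ^ (r - 1 / 2) * (√|ζ| * (brak η ^ (r - 1 / 2) * brak ζ ^ (1 / 2 : ℝ) +
          brak ζ ^ (r - 1 / 2) * brak ζ ^ (1 / 2 : ℝ))) := by ring
    _ ≤ 2 ^ (r - 1 / 2) * (√|ζ| * (brak η ^ (r - 1 / 2) * brak ζ ^ r * (brak ζ)⁻¹ +
          brak η ^ (r - 1 / 2) * brak ζ ^ r * (brak η)⁻¹)) := by gcongr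
    _ = _ := by ring

lemma P3 {r : ℝ} (hr : 2 < r) (η ζ : ℝ) :
    brak (η + ζ) ^ (r - 1 / 2) * |ζ| ≤ 2 * 2 ^ (r - 1 / 2) *
      (brak ζ ^ (r - 1 / 2) * brak η ^ r * √|ζ| * √(brak (η + ζ)) *
        ((brak η)⁻¹ + (brak ζ)⁻¹)) := by
  have p1 := brak_pos η
  have p2 := brak_pos ζ
  have p3 := brak_pos (η + ζ)
  have hJ : brak ζ ^ (1 / 2 : ℝ) ≤ 2 * (√(brak (η + ζ)) * brak η ^ (1 / 2 : ℝ)) := by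
    have := brak_rpow_mul (s := 1 / 2) (by norm_num) (η + ζ) (-η)
    rw [brak_sub, show η + ζ + -η = ζ by ring] at this
    refine this.trans ?_
    rw [Real.sqrt_eq_rpow]
    gcongr
    calc (2 : ℝ) ^ (1 / 2 : ℝ) ≤ 2 ^ (1 : ℝ) := by gcongr <;> norm_num
      _ = 2 := by norm_num
  have hs1 : 1 ≤ √(brak (η + ζ)) := Real.one_le_sqrt.2 (one_le_brak _)
  have e1 : brak ζ ^ (r - 1 / 2) * brak ζ ^ (1 / 2 : ℝ) ≤
      2 * (brak ζ ^ (r - 1 / 2) * brak η ^ r * √(brak (η + ζ)) * (brak η)⁻¹) := by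
    calc _ ≤ brak ζ ^ (r - 1 / 2) * (2 * (√(brak (η + ζ)) * brak η ^ (1 / 2 : ℝ))) := by gcongr
      _ ≤ brak ζ ^ (r - 1 / 2) * (2 * (√(brak (η + ζ)) * brak η ^ (r + -1))) := by
          gcongr
          · exact one_le_brak η
          · linarith
      _ = _ := by rw [Real.rpow_add p1, Real.rpow_neg_one]; ring
  have e2 : brak η ^ (r - 1 / 2) * brak ζ ^ (1 / 2 : ℝ) ≤
      2 * (brak ζ ^ (r - 1 / 2) * brak η ^ r * √(brak (η + ζ)) * (brak ζ)⁻¹) := by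
    calc _ ≤ brak η ^ r * brak ζ ^ (r - 1 / 2 + -1) := by
          gcongr
          · exact one_le_brak η
          · linarith
          · exact one_le_brak ζ
          · linarith
      _ ≤ (2 * √(brak (η + ζ))) * (brak η ^ r * brak ζ ^ (r - 1 / 2 + -1)) := by
          apply le_mul_of_one_le_left (by positivity); linarith
      _ = _ := by rw [Real.rpow_add p2, Real.rpow_neg_one]; ring
  calc _ ≤ (2 ^ (r - 1 / 2) * (brak η ^ (r - 1 / 2) + brak ζ ^ (r - 1 / 2))) *
        (√|ζ| * brak ζ ^ (1 / 2 : ℝ)) := by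
        gcongr
        · exact brak_rpow_add (by linarith) η ζ
        · exact abs_le_sqrt_mul ζ
    _ = 2 ^ (r - 1 / 2) * (√|ζ| * (brak η ^ (r - 1 / 2) * brak ζ ^ (1 / 2 : ℝ) +
          brak ζ ^ (r - 1 / 2) * brak ζ ^ (1 / 2 : ℝ))) := by ring
    _ ≤ 2 ^ (r - 1 / 2) * (√|ζ| * (2 * (brak ζ ^ (r - 1 / 2) * brak η ^ r * √(brak (η + ζ)) *
          (brak ζ)⁻¹) +
          2 * (brak ζ ^ (r - 1 / 2) * brak η ^ r * √(brak (η + ζ)) * (brak η)⁻¹))) := by gcongr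
    _ = _ := by ring

/-- common bound for the second and fourth terms: `m` is `|η|` or `|ζ|` -/
lemma P24 {r : ℝ} (hr : 2 < r) (η ζ m : ℝ) (hm0 : 0 ≤ m) (hm : m ≤ brak η * brak ζ) :
    brak (η + ζ) ^ (r - 1 / 2) * m * (brak ζ ^ 2)⁻¹ ≤ 2 ^ (r - 1 / 2) *
      (brak η ^ (r + 1 / 2) * brak ζ ^ r * (brak ζ)⁻¹) := by
  have p1 := brak_pos η
  have p2 := brak_pos ζ
  calc _ ≤ (2 ^ (r - 1 / 2) * (brak η ^ (r - 1 / 2) * brak ζ ^ (r - 1 / 2))) *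
          (brak η * brak ζ) * (brak ζ ^ 2)⁻¹ := by
        gcongr
        exact brak_rpow_mul (by linarith) η ζ
    _ = 2 ^ (r - 1 / 2) * ((brak η ^ (r - 1 / 2) * brak η) * brak ζ ^ (r - 1 / 2) *
          (brak ζ)⁻¹) := by field_simp
    _ ≤ 2 ^ (r - 1 / 2) * (brak η ^ (r + 1 / 2) * brak ζ ^ r * (brak ζ)⁻¹) := by
        gcongr
        · rw [← Real.rpow_add_one p1.ne']
          apply le_of_eq; congr 1; ring
        · exact one_le_brak ζ
        · linarith

/-- `c = ⟨ξ⟩²/κ` -/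
def cc (ε t ξ : ℝ) : ℝ := (1 + ξ ^ 2) / (1 + t / ε)

lemma theta_eq (ε t ξ y : ℝ) :
    theta ε t ξ y = 1 - Real.exp (-(cc ε t ξ * y ^ 2 / 2)) := by
  unfold theta cc
  congr 2
  rw [mul_comm 2 (1 + t / ε), ← div_div]
  ring

lemma deriv_theta (ε t ξ : ℝ) :
    deriv (theta ε t ξ) = fun y => cc ε t ξ * y * Real.exp (-(cc ε t ξ * y ^ 2 / 2)) := by
  have : theta ε t ξ = fun y => 1 - Real.exp (-(cc ε t ξ * y ^ 2 / 2)) := by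
    ext y; exact theta_eq ε t ξ y
  rw [this]
  ext y
  have h : HasDerivAt (fun y : ℝ => -(cc ε t ξ * y ^ 2 / 2)) (-(cc ε t ξ * y)) y := by
    have := (((hasDerivAt_pow 2 y).const_mul (cc ε t ξ)).div_const 2).neg
    refine this.congr_deriv ?_
    norm_num
    ring
  have h2 := (h.exp.const_sub 1).deriv
  rw [h2]; ring

lemma deriv2_theta (ε t ξ y : ℝ) :
    deriv (deriv (theta ε t ξ)) y = (cc ε t ξ - cc ε t ξ ^ 2 * y ^ 2) *
      Real.exp (-(cc ε t ξ * y ^ 2 / 2)) := by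
  rw [deriv_theta]
  have h : HasDerivAt (fun y : ℝ => -(cc ε t ξ * y ^ 2 / 2)) (-(cc ε t ξ * y)) y := by
    have := (((hasDerivAt_pow 2 y).const_mul (cc ε t ξ)).div_const 2).neg
    refine this.congr_deriv ?_
    norm_num
    ring
  have h3 : HasDerivAt (fun y : ℝ => cc ε t ξ * y) (cc ε t ξ) y := by
    simpa using (hasDerivAt_id y).const_mul (cc ε t ξ)
  exact (h3.mul h.exp).deriv.trans (by ring)

lemma kappa_bd {ε t : ℝ} (hε : 0 < ε) (ht : 0 ≤ t) (hte : t ≤ ε) :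
    1 ≤ 1 + t / ε ∧ 1 + t / ε ≤ 2 := by
  constructor
  · have : 0 ≤ t / ε := by positivity
    linarith
  · have : t / ε ≤ 1 := (div_le_one hε).2 hte
    linarith

lemma theta_abs_le {ε t : ℝ} (hε : 0 < ε) (ht : 0 ≤ t) (hte : t ≤ ε) (ξ y : ℝ) :
    |theta ε t ξ y| ≤ 1 := by
  obtain ⟨k1, k2⟩ := kappa_bd hε ht hte
  rw [theta_eq]
  have hc : 0 ≤ cc ε t ξ := by unfold cc; positivity
  have h1 : Real.exp (-(cc ε t ξ * y ^ 2 / 2)) ≤ 1 := by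
    rw [Real.exp_le_one_iff]
    have : 0 ≤ cc ε t ξ * y ^ 2 / 2 := by positivity
    linarith
  have h2 := Real.exp_pos (-(cc ε t ξ * y ^ 2 / 2))
  rw [abs_le]; constructor <;> linarith

/-- large numeric constant -/
def KK : ℝ := 4 * (8 ^ 6 * 720)

lemma exp_decay {X : ℝ} (hX : 1 ≤ X) {n : ℕ} (hn : n ≤ 6) :
    X ^ n * Real.exp (-(X / 8)) ≤ 8 ^ 6 * 720 := by
  have h := Real.pow_div_factorial_le_exp (X / 8) (by positivity) 6
  have h1 : X ^ n ≤ X ^ 6 := pow_le_pow_right₀ hX hn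
  rw [Real.exp_neg, ← div_eq_mul_inv, div_le_iff₀ (Real.exp_pos _)]
  refine h1.trans ?_
  have h6 : ((6 : ℕ).factorial : ℝ) = 720 := by norm_num [Nat.factorial]
  rw [h6, div_pow, div_div, div_le_iff₀ (by norm_num)] at h
  linarith

lemma cc_bd {ε t : ℝ} (hε : 0 < ε) (ht : 0 ≤ t) (hte : t ≤ ε) (ξ : ℝ) :
    0 ≤ cc ε t ξ ∧ cc ε t ξ ≤ brak ξ ^ 2 := by
  obtain ⟨k1, k2⟩ := kappa_bd hε ht hte
  rw [brak_sq]; unfold cc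
  refine ⟨by positivity, div_le_self (by positivity) k1⟩

lemma rho_exp_bd {ε t : ℝ} (hε : 0 < ε) (ht : 0 ≤ t) (hte : t ≤ ε) (ξ y : ℝ) :
    rho ε t y * Real.exp (-(cc ε t ξ * y ^ 2 / 2)) ≤ Real.exp (-((y ^ 2 * brak ξ ^ 2) / 8)) := by
  obtain ⟨k1, k2⟩ := kappa_bd hε ht hte
  unfold rho cc
  rw [← Real.exp_add, Real.exp_le_exp, brak_sq]
  set κ := 1 + t / ε
  have hκ : 0 < κ := by linarith
  have : y ^ 2 / (8 * κ) + -((1 + ξ ^ 2) / κ * y ^ 2 / 2) =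
      -(y ^ 2 * (3 + 4 * ξ ^ 2) / (8 * κ)) := by field_simp; ring
  rw [this, neg_le_neg_iff, div_le_div_iff₀ (by norm_num) (by positivity)]
  have : 0 ≤ y ^ 2 := sq_nonneg y
  have : 0 ≤ y ^ 2 * ξ ^ 2 := by positivity
  nlinarith [mul_nonneg (sub_nonneg.2 k2) (by positivity : 0 ≤ y ^ 2 * (1 + ξ ^ 2))]

lemma one_le_rho {ε t : ℝ} (hε : 0 < ε) (ht : 0 ≤ t) (hte : t ≤ ε) (y : ℝ) :
    1 ≤ rho ε t y := by
  obtain ⟨k1, k2⟩ := kappa_bd hε ht hte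
  unfold rho
  rw [Real.one_le_exp_iff]; positivity

lemma dtheta_bd {ε t : ℝ} (hε : 0 < ε) (ht : 0 ≤ t) (hte : t ≤ ε) (ξ y : ℝ) (hy : 1 ≤ y) :
    |deriv (theta ε t ξ) y| ≤ KK * (brak ξ ^ 2)⁻¹ := by
  obtain ⟨c0, c1⟩ := cc_bd hε ht hte ξ
  have hJ := one_le_brak ξ
  have hJ0 := brak_pos ξ
  rw [deriv_theta, abs_of_nonneg (by positivity), ← div_eq_mul_inv, le_div_iff₀ (by positivity)]
  have hE : Real.exp (-(cc ε t ξ * y ^ 2 / 2)) ≤ Real.exp (-((y ^ 2 * brak ξ ^ 2) / 8)) :=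
    le_trans (le_mul_of_one_le_left (Real.exp_pos _).le (one_le_rho hε ht hte y))
      (rho_exp_bd hε ht hte ξ y)
  have hX : 1 ≤ y ^ 2 * brak ξ ^ 2 := one_le_mul_of_one_le_of_one_le
    (one_le_pow₀ hy) (one_le_pow₀ hJ)
  have hy4 : y ≤ y ^ 4 := le_self_pow₀ hy (by norm_num)
  calc cc ε t ξ * y * Real.exp (-(cc ε t ξ * y ^ 2 / 2)) * brak ξ ^ 2
      ≤ brak ξ ^ 2 * y ^ 4 * Real.exp (-((y ^ 2 * brak ξ ^ 2) / 8)) * brak ξ ^ 2 := by gcongr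
    _ = (y ^ 2 * brak ξ ^ 2) ^ 2 * Real.exp (-((y ^ 2 * brak ξ ^ 2) / 8)) := by ring
    _ ≤ 8 ^ 6 * 720 := exp_decay hX (by norm_num)
    _ ≤ KK := by unfold KK; norm_num

lemma ddtheta_bd {ε t : ℝ} (hε : 0 < ε) (ht : 0 ≤ t) (hte : t ≤ ε) (ξ y : ℝ) (hy : 1 ≤ y) :
    rho ε t y * √y * |deriv (deriv (theta ε t ξ)) y| ≤ KK * (brak y)⁻¹ * (brak ξ ^ 2)⁻¹ := by
  obtain ⟨c0, c1⟩ := cc_bd hε ht hte ξ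
  have hJ := one_le_brak ξ
  have hJ0 := brak_pos ξ
  have hJy := brak_pos y
  have hy0 : 0 < y := by linarith
  have hr0 : 0 < rho ε t y := Real.exp_pos _
  have hX : 1 ≤ y ^ 2 * brak ξ ^ 2 := one_le_mul_of_one_le_of_one_le
    (one_le_pow₀ hy) (one_le_pow₀ hJ)
  have hby : brak y ≤ 2 * y := by
    refine abs_le_of_sq_le_sq' ?_ (by positivity) |>.2
    rw [brak_sq]; nlinarith
  have hsy : √y ≤ y := by
    rw [Real.sqrt_le_left hy0.le]; nlinarith
  have habs : |cc ε t ξ - cc ε t ξ ^ 2 * y ^ 2| ≤ 2 * (brak ξ ^ 2 * (y ^ 2 * brak ξ ^ 2)) := by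
    have e1 : cc ε t ξ ≤ brak ξ ^ 2 * (y ^ 2 * brak ξ ^ 2) :=
      c1.trans (le_mul_of_one_le_right (by positivity) hX)
    have e2 : cc ε t ξ ^ 2 * y ^ 2 ≤ brak ξ ^ 2 * (y ^ 2 * brak ξ ^ 2) := by
      calc cc ε t ξ ^ 2 * y ^ 2 ≤ (brak ξ ^ 2) ^ 2 * y ^ 2 := by gcongr
        _ = _ := by ring
    have e3 : 0 ≤ cc ε t ξ ^ 2 * y ^ 2 := by positivity
    rw [abs_le]; constructor <;> linarith
  rw [deriv2_theta, abs_mul, abs_of_pos (Real.exp_pos _), ← div_eq_mul_inv, ← div_eq_mul_inv,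
    div_div, le_div_iff₀ (by positivity)]
  calc rho ε t y * √y * (|cc ε t ξ - cc ε t ξ ^ 2 * y ^ 2| *
        Real.exp (-(cc ε t ξ * y ^ 2 / 2))) * (brak y * brak ξ ^ 2)
      = √y * |cc ε t ξ - cc ε t ξ ^ 2 * y ^ 2| * (rho ε t y *
        Real.exp (-(cc ε t ξ * y ^ 2 / 2))) * (brak y * brak ξ ^ 2) := by ring
    _ ≤ y * (2 * (brak ξ ^ 2 * (y ^ 2 * brak ξ ^ 2))) *
        Real.exp (-((y ^ 2 * brak ξ ^ 2) / 8)) * ((2 * y) * brak ξ ^ 2) := by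
        gcongr
        exact rho_exp_bd hε ht hte ξ y
    _ = 4 * ((y ^ 2 * brak ξ ^ 2) ^ 2 * brak ξ ^ 2 * 1 *
          Real.exp (-((y ^ 2 * brak ξ ^ 2) / 8))) := by ring
    _ ≤ 4 * ((y ^ 2 * brak ξ ^ 2) ^ 2 * brak ξ ^ 2 * y ^ 2 *
          Real.exp (-((y ^ 2 * brak ξ ^ 2) / 8))) := by
        gcongr; exact one_le_pow₀ hy
    _ = 4 * ((y ^ 2 * brak ξ ^ 2) ^ 3 * Real.exp (-((y ^ 2 * brak ξ ^ 2) / 8))) := by ring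
    _ ≤ KK := by
        unfold KK
        gcongr 4 * ?_
        exact exp_decay (n := 3) hX (by norm_num)

def gR (ε t τ s : ℝ) (χ : ℝ → ℝ) (w : ℝ → ℝ → ℂ) (ξ y : ℝ) : ℝ :=
  χ y * rho ε t y * Real.exp (τ * |ξ|) * brak ξ ^ s * ‖deriv (w ξ) y‖

def hR (ε t τ r : ℝ) (w : ℝ → ℝ → ℂ) (ξ y : ℝ) : ℝ :=
  rho ε t y * Real.exp (τ * |ξ|) * brak ξ ^ (r + 1 / 2) * ‖w ξ y‖

def aR (τ r : ℝ) (A : ℝ → ℂ) (ξ : ℝ) : ℝ :=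
  Real.exp (τ * |ξ|) * brak ξ ^ r * ‖A ξ‖

lemma exp_two (τ ξ : ℝ) : Real.exp (2 * τ * |ξ|) = Real.exp (τ * |ξ|) ^ 2 := by
  rw [← Real.exp_nat_mul]; congr 1; push_cast; ring

lemma brak_two (s ξ : ℝ) : brak ξ ^ (2 * s) = (brak ξ ^ s) ^ 2 := by
  rw [mul_comm, Real.rpow_mul (brak_pos ξ).le, Real.rpow_two]

lemma wgt_eq (ε t τ s ξ y : ℝ) :
    wgt ε t τ s ξ y = (rho ε t y * Real.exp (τ * |ξ|) * brak ξ ^ s) ^ 2 := by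
  unfold wgt; rw [exp_two, brak_two]; ring

lemma gR_sq (ε t τ s : ℝ) (χ : ℝ → ℝ) (w : ℝ → ℝ → ℂ) (ξ y : ℝ) :
    gR ε t τ s χ w ξ y ^ 2 = ‖((χ y : ℝ) : ℂ) * deriv (w ξ) y‖ ^ 2 * wgt ε t τ s ξ y := by
  rw [wgt_eq, gR, norm_mul, Complex.norm_real, Real.norm_eq_abs]
  have : |χ y| ^ 2 = χ y ^ 2 := sq_abs _
  rw [mul_pow |χ y|, this]; ring

lemma hR_sq (ε t τ r : ℝ) (w : ℝ → ℝ → ℂ) (ξ y : ℝ) :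
    hR ε t τ r w ξ y ^ 2 = brak ξ * ‖w ξ y‖ ^ 2 * wgt ε t τ r ξ y := by
  have : brak ξ ^ (r + 1 / 2) * brak ξ ^ (r + 1 / 2) = brak ξ * (brak ξ ^ r) ^ 2 := by
    rw [← Real.rpow_add (brak_pos ξ), ← brak_two, mul_comm, ← Real.rpow_add_one (brak_pos ξ).ne']
    congr 1; ring
  rw [wgt_eq, hR]
  linear_combination (rho ε t y * Real.exp (τ * |ξ|) * ‖w ξ y‖) ^ 2 * this

lemma aR_sq (τ r : ℝ) (A : ℝ → ℂ) (ξ : ℝ) :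
    aR τ r A ξ ^ 2 = ‖A ξ‖ ^ 2 * aWgt τ r ξ := by
  unfold aR aWgt; rw [exp_two, brak_two]; ring

lemma exp_add_le {τ : ℝ} (hτ : 0 < τ) (η ζ : ℝ) :
    Real.exp (τ * |η + ζ|) ≤ Real.exp (τ * |η|) * Real.exp (τ * |ζ|) := by
  rw [← Real.exp_add, Real.exp_le_exp, ← mul_add]
  gcongr; exact abs_add_le η ζ

def KC (r : ℝ) : ℝ := 2 * 2 ^ (r - 1 / 2) * KK

lemma KK_ge : 1 ≤ KK := by unfold KK; norm_num
lemma KC_pos (r : ℝ) : 0 < KC r := by unfold KC KK; positivity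
lemma KC_ge (r : ℝ) : 2 * 2 ^ (r - 1 / 2) ≤ KC r := le_mul_of_one_le_right (by positivity) KK_ge
lemma KC_ge' (r : ℝ) : (2 : ℝ) ^ (r - 1 / 2) ≤ KC r :=
  le_trans (by linarith [Real.rpow_pos_of_pos (zero_lt_two) (r - 1 / 2)]) (KC_ge r)
lemma KC_ge2 (r : ℝ) : KK * (2 : ℝ) ^ (r - 1 / 2) ≤ KC r := by
  unfold KC
  have : 0 < KK * (2 : ℝ) ^ (r - 1 / 2) := by unfold KK; positivity
  linarith

section pw
variable {r ε t τ : ℝ} {χ : ℝ → ℝ} {w : ℝ → ℝ → ℂ} {A : ℝ → ℂ}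

lemma pw1 (hr : 2 < r) (hε : 0 < ε) (ht : 0 ≤ t) (hte : t ≤ ε) (hτ : 0 < τ)
    (hχ : ∀ y, 0 ≤ χ y) (η ζ y : ℝ) :
    ‖deriv (w η) y‖ * |ζ| * ‖A ζ‖ * |theta ε t ζ y| *
      (χ y * rho ε t y * Real.exp (τ * |η + ζ|) * brak (η + ζ) ^ (r - 1 / 2)) ≤
    KC r * (gR ε t τ (r - 1 / 2) χ w η y * (√|ζ| * aR τ r A ζ) *
      ((brak ζ)⁻¹ + (brak η)⁻¹)) := by
  have p1 := brak_pos η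
  have p2 := brak_pos ζ
  have p3 := brak_pos (η + ζ)
  have hr0 : 0 < rho ε t y := Real.exp_pos _
  have hc := hχ y
  have hKC := KC_pos r
  calc _ = (‖deriv (w η) y‖ * ‖A ζ‖ * χ y * rho ε t y) * |theta ε t ζ y| *
        Real.exp (τ * |η + ζ|) * (brak (η + ζ) ^ (r - 1 / 2) * |ζ|) := by ring
    _ ≤ (‖deriv (w η) y‖ * ‖A ζ‖ * χ y * rho ε t y) * 1 *
        (Real.exp (τ * |η|) * Real.exp (τ * |ζ|)) * (KC r *
      (brak η ^ (r - 1 / 2) * brak ζ ^ r * √|ζ| * ((brak ζ)⁻¹ + (brak η)⁻¹))) := by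
        gcongr _ * ?_ * ?_ * ?_
        · exact theta_abs_le hε ht hte ζ y
        · exact exp_add_le hτ η ζ
        · refine (P1 hr η ζ).trans ?_
          gcongr; exact KC_ge' r
    _ = _ := by unfold gR aR; ring

lemma pw2 (hr : 2 < r) (hε : 0 < ε) (ht : 0 ≤ t) (hte : t ≤ ε) (hτ : 0 < τ)
    (hχ : ∀ y, 0 ≤ χ y) (hχ1 : ∀ y, χ y ≤ 1) (η ζ y : ℝ) (hy : 1 ≤ y) :
    ‖w η y‖ * |ζ| * ‖A ζ‖ * |deriv (theta ε t ζ) y| *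
      (χ y * rho ε t y * Real.exp (τ * |η + ζ|) * brak (η + ζ) ^ (r - 1 / 2)) ≤
    KC r * (hR ε t τ r w η y * aR τ r A ζ * ((brak ζ)⁻¹ + (brak η)⁻¹)) := by
  have p1 := brak_pos η
  have p2 := brak_pos ζ
  have p3 := brak_pos (η + ζ)
  have hr0 : 0 < rho ε t y := Real.exp_pos _
  have hc := hχ y
  have hKC := KC_pos r
  have hK : 0 < KK := by linarith [KK_ge]
  have hm : |ζ| ≤ brak η * brak ζ :=
    (abs_le_brak ζ).trans (le_mul_of_one_le_left p2.le (one_le_brak η))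
  calc _ = (‖w η y‖ * ‖A ζ‖ * rho ε t y * χ y) * |deriv (theta ε t ζ) y| *
        Real.exp (τ * |η + ζ|) * (brak (η + ζ) ^ (r - 1 / 2) * |ζ|) := by ring
    _ ≤ (‖w η y‖ * ‖A ζ‖ * rho ε t y * 1) * (KK * (brak ζ ^ 2)⁻¹) *
        (Real.exp (τ * |η|) * Real.exp (τ * |ζ|)) *
          (brak (η + ζ) ^ (r - 1 / 2) * |ζ|) := by
        gcongr
        · exact hχ1 y
        · exact dtheta_bd hε ht hte ζ y hy
        · exact exp_add_le hτ η ζ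
    _ = (‖w η y‖ * ‖A ζ‖ * rho ε t y) * (Real.exp (τ * |η|) * Real.exp (τ * |ζ|)) *
          (KK * (brak (η + ζ) ^ (r - 1 / 2) * |ζ| * (brak ζ ^ 2)⁻¹)) := by ring
    _ ≤ (‖w η y‖ * ‖A ζ‖ * rho ε t y) * (Real.exp (τ * |η|) * Real.exp (τ * |ζ|)) *
          (KK * (2 ^ (r - 1 / 2) *
      (brak η ^ (r + 1 / 2) * brak ζ ^ r * (brak ζ)⁻¹))) := by
        gcongr ?_ * (_ * ?_)
        exact P24 hr η ζ _ (abs_nonneg _) hm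
    _ = (KK * 2 ^ (r - 1 / 2)) * (hR ε t τ r w η y * aR τ r A ζ * ((brak ζ)⁻¹ + 0)) := by
        unfold hR aR; ring
    _ ≤ _ := by
        have : 0 ≤ hR ε t τ r w η y := by unfold hR; positivity
        have : 0 ≤ aR τ r A ζ := by unfold aR; positivity
        gcongr
        · exact KC_ge2 r
        · exact (inv_pos.2 p1).le

lemma pw3 (hr : 2 < r) (hε : 0 < ε) (ht : 0 ≤ t) (hte : t ≤ ε) (hτ : 0 < τ)
    (hχ : ∀ y, 0 ≤ χ y) (η ζ y : ℝ) :
    ‖A η‖ * |theta ε t η y| * |ζ| * ‖deriv (w ζ) y‖ *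
      (χ y * rho ε t y * Real.exp (τ * |η + ζ|) * brak (η + ζ) ^ (r - 1 / 2)) ≤
    KC r * (√(brak (η + ζ)) * (√|ζ| * gR ε t τ (r - 1 / 2) χ w ζ y) * aR τ r A η *
      ((brak η)⁻¹ + (brak ζ)⁻¹)) := by
  have p1 := brak_pos η
  have p2 := brak_pos ζ
  have p3 := brak_pos (η + ζ)
  have hr0 : 0 < rho ε t y := Real.exp_pos _
  have hc := hχ y
  have hKC := KC_pos r
  calc _ = (‖deriv (w ζ) y‖ * ‖A η‖ * χ y * rho ε t y) * |theta ε t η y| *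
        Real.exp (τ * |η + ζ|) * (brak (η + ζ) ^ (r - 1 / 2) * |ζ|) := by ring
    _ ≤ (‖deriv (w ζ) y‖ * ‖A η‖ * χ y * rho ε t y) * 1 *
        (Real.exp (τ * |η|) * Real.exp (τ * |ζ|)) * (KC r *
      (brak ζ ^ (r - 1 / 2) * brak η ^ r * √|ζ| * √(brak (η + ζ)) *
        ((brak η)⁻¹ + (brak ζ)⁻¹))) := by
        gcongr _ * ?_ * ?_ * ?_
        · exact theta_abs_le hε ht hte η y
        · exact exp_add_le hτ η ζ
        · refine (P3 hr η ζ).trans ?_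
          gcongr; exact KC_ge r
    _ = _ := by unfold gR aR; ring

lemma pw4 (hr : 2 < r) (hε : 0 < ε) (ht : 0 ≤ t) (hte : t ≤ ε) (hτ : 0 < τ)
    (hχ : ∀ y, 0 ≤ χ y) (hχ1 : ∀ y, χ y ≤ 1) (η ζ y : ℝ) (hy : 1 ≤ y) (H I : ℝ) (hH0 : 0 ≤ H)
    (hI0 : 0 ≤ I) (hH : Real.exp (τ * |η|) * brak η ^ (r + 1 / 2) * I ≤ √y * H) :
    |η| * I * ‖A ζ‖ * |deriv (deriv (theta ε t ζ)) y| *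
      (χ y * rho ε t y * Real.exp (τ * |η + ζ|) * brak (η + ζ) ^ (r - 1 / 2)) ≤
    KC r * (((brak y)⁻¹ * H) * aR τ r A ζ * ((brak ζ)⁻¹ + (brak η)⁻¹)) := by
  have p1 := brak_pos η
  have p2 := brak_pos ζ
  have p3 := brak_pos (η + ζ)
  have p4 := brak_pos y
  have hr0 : 0 < rho ε t y := Real.exp_pos _
  have hc := hχ y
  have hKC := KC_pos r
  have hK : 0 < KK := by linarith [KK_ge]
  have hm : |η| ≤ brak η * brak ζ :=
    (abs_le_brak η).trans (le_mul_of_one_le_right p1.le (one_le_brak ζ))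
  have hmul : brak (η + ζ) ^ (r - 1 / 2) * |η| ≤ (2 ^ (r - 1 / 2) *
      (brak η ^ (r + 1 / 2) * brak ζ ^ r * (brak ζ)⁻¹)) * brak ζ ^ 2 := by
    have := P24 hr η ζ _ (abs_nonneg _) hm
    rwa [← div_eq_mul_inv, div_le_iff₀ (by positivity)] at this
  calc _ = (I * ‖A ζ‖ * rho ε t y * χ y) * |deriv (deriv (theta ε t ζ)) y| *
        Real.exp (τ * |η + ζ|) * (brak (η + ζ) ^ (r - 1 / 2) * |η|) := by ring
    _ ≤ (I * ‖A ζ‖ * rho ε t y * 1) * |deriv (deriv (theta ε t ζ)) y| *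
        (Real.exp (τ * |η|) * Real.exp (τ * |ζ|)) * ((2 ^ (r - 1 / 2) *
      (brak η ^ (r + 1 / 2) * brak ζ ^ r * (brak ζ)⁻¹)) * brak ζ ^ 2) := by
        gcongr
        · exact hχ1 y
        · exact exp_add_le hτ η ζ
    _ = 2 ^ (r - 1 / 2) * (Real.exp (τ * |η|) * brak η ^ (r + 1 / 2) * I) * rho ε t y *
          |deriv (deriv (theta ε t ζ)) y| * (aR τ r A ζ * (brak ζ)⁻¹ * brak ζ ^ 2) := by
        unfold aR; ring
    _ ≤ 2 ^ (r - 1 / 2) * (√y * H) * rho ε t y *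
          |deriv (deriv (theta ε t ζ)) y| * (aR τ r A ζ * (brak ζ)⁻¹ * brak ζ ^ 2) := by
        have : 0 ≤ aR τ r A ζ := by unfold aR; positivity
        gcongr
    _ = 2 ^ (r - 1 / 2) * H * (rho ε t y * √y *
          |deriv (deriv (theta ε t ζ)) y|) * (aR τ r A ζ * (brak ζ)⁻¹ * brak ζ ^ 2) := by ring
    _ ≤ 2 ^ (r - 1 / 2) * H * (KK * (brak y)⁻¹ * (brak ζ ^ 2)⁻¹) *
          (aR τ r A ζ * (brak ζ)⁻¹ * brak ζ ^ 2) := by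
        have : 0 ≤ aR τ r A ζ := by unfold aR; positivity
        gcongr ?_ * ?_ * ?_
        exact ddtheta_bd hε ht hte ζ y hy
    _ = (KK * 2 ^ (r - 1 / 2)) * (((brak y)⁻¹ * H) * aR τ r A ζ * ((brak ζ)⁻¹ + 0)) := by
        field_simp; ring
    _ ≤ _ := by
        have : 0 ≤ aR τ r A ζ := by unfold aR; positivity
        gcongr
        · exact KC_ge2 r
        · exact (inv_pos.2 p1).le

lemma pw (hr : 2 < r) (hε : 0 < ε) (ht : 0 ≤ t) (hte : t ≤ ε) (hτ : 0 < τ)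
    (hχ : ∀ y, 0 ≤ χ y) (hχ1 : ∀ y, χ y ≤ 1) (hχ0 : ∀ y : ℝ, y ≤ 1 → χ y = 0)
    (ξ η y : ℝ) (H : ℝ) (hH0 : 0 ≤ H)
    (hH : Real.exp (τ * |η|) * brak η ^ (r + 1 / 2) * ‖Iy (w η) y‖ ≤ √y * H) :
    ‖(deriv (w η) y * ((ξ - η : ℝ) : ℂ) * A (ξ - η) * ((theta ε t (ξ - η) y : ℝ) : ℂ)
      + w η y * ((ξ - η : ℝ) : ℂ) * A (ξ - η) * ((deriv (theta ε t (ξ - η)) y : ℝ) : ℂ)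
      + A η * ((theta ε t η y : ℝ) : ℂ) * ((ξ - η : ℝ) : ℂ) * deriv (w (ξ - η)) y
      - (η : ℂ) * Iy (w η) y * A (ξ - η) *
          ((deriv (deriv (theta ε t (ξ - η))) y : ℝ) : ℂ))‖ * ‖deriv (w ξ) y‖ *
        (χ y ^ 2 * wgt ε t τ (r - 1 / 2) ξ y) ≤
    KC r * (gR ε t τ (r - 1 / 2) χ w ξ y * gR ε t τ (r - 1 / 2) χ w η y *
          (√|ξ - η| * aR τ r A (ξ - η)) * ((brak (ξ - η))⁻¹ + (brak η)⁻¹)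
      + gR ε t τ (r - 1 / 2) χ w ξ y * hR ε t τ r w η y * aR τ r A (ξ - η) *
          ((brak (ξ - η))⁻¹ + (brak η)⁻¹)
      + (√(brak ξ) * gR ε t τ (r - 1 / 2) χ w ξ y) *
          (√|ξ - η| * gR ε t τ (r - 1 / 2) χ w (ξ - η) y) * aR τ r A η *
          ((brak η)⁻¹ + (brak (ξ - η))⁻¹)
      + gR ε t τ (r - 1 / 2) χ w ξ y * ((brak y)⁻¹ * H) * aR τ r A (ξ - η) *
          ((brak (ξ - η))⁻¹ + (brak η)⁻¹)) := by
  obtain ⟨ζ, rfl⟩ : ∃ ζ, ξ = η + ζ := ⟨ξ - η, by ring⟩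
  rw [show η + ζ - η = ζ by ring]
  have p1 := brak_pos η
  have p2 := brak_pos ζ
  have p3 := brak_pos (η + ζ)
  have p4 := brak_pos y
  have hr0 : 0 < rho ε t y := Real.exp_pos _
  have hc := hχ y
  have hKC := KC_pos r
  have hg : ∀ ξ, 0 ≤ gR ε t τ (r - 1 / 2) χ w ξ y := fun ξ => by
    have := brak_pos ξ
    unfold gR; positivity
  rcases le_total y 1 with hy | hy
  · have hz : ∀ ξ, gR ε t τ (r - 1 / 2) χ w ξ y = 0 := fun ξ => by
      unfold gR; rw [hχ0 y hy]; ring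
    simp only [hχ0 y hy, hz]; simp
  set Q := χ y * rho ε t y * Real.exp (τ * |η + ζ|) * brak (η + ζ) ^ (r - 1 / 2) with hQ
  have hQ0 : 0 ≤ Q := by positivity
  have h1 := pw1 (w := w) (A := A) hr hε ht hte hτ hχ η ζ y
  have h2 := pw2 (w := w) (A := A) hr hε ht hte hτ hχ hχ1 η ζ y hy
  have h3 := pw3 (w := w) (A := A) hr hε ht hte hτ hχ η ζ y
  have h4 := pw4 (A := A) hr hε ht hte hτ hχ hχ1 η ζ y hy H _ hH0 (norm_nonneg _) hH
  rw [← hQ] at h1 h2 h3 h4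
  have e1 : ‖deriv (w (η + ζ)) y‖ * (χ y ^ 2 * wgt ε t τ (r - 1 / 2) (η + ζ) y) =
      Q * gR ε t τ (r - 1 / 2) χ w (η + ζ) y := by
    rw [wgt_eq, hQ]; unfold gR; ring
  rw [mul_assoc, e1, ← mul_assoc]
  refine (mul_le_mul_of_nonneg_right (mul_le_mul_of_nonneg_right ((norm_sub_le _ _).trans
    (add_le_add_left ((norm_add_le _ _).trans (add_le_add_left (norm_add_le _ _) _)) _)) hQ0)
      (hg (η + ζ))).trans ?_
  simp only [norm_mul, Complex.norm_real, Real.norm_eq_abs]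
  refine (mul_le_mul_of_nonneg_right (by linarith [h1, h2, h3, h4] :
    _ ≤ (KC r * (gR ε t τ (r - 1 / 2) χ w η y * (√|ζ| * aR τ r A ζ) *
      ((brak ζ)⁻¹ + (brak η)⁻¹))) + (KC r * (hR ε t τ r w η y * aR τ r A ζ * ((brak ζ)⁻¹ + (brak η)⁻¹)))
      + (KC r * (√(brak (η + ζ)) * (√|ζ| * gR ε t τ (r - 1 / 2) χ w ζ y) * aR τ r A η *
      ((brak η)⁻¹ + (brak ζ)⁻¹)))
      + (KC r * (((brak y)⁻¹ * H) * aR τ r A ζ * ((brak ζ)⁻¹ + (brak η)⁻¹))))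
      (hg (η + ζ))).trans (le_of_eq ?_)
  ring

end pw

/-- measure on the half line -/
abbrev nu : Measure ℝ := (volume : Measure ℝ).restrict (Ioi 0)

lemma nn_const_mul {α : Type*} [MeasurableSpace α] (μ : Measure α) {f : α → ℝ≥0∞}
    (hf : Measurable f) (c : ℝ≥0∞) : nn μ (fun x => f x * c) = nn μ f * c := by
  apply nn_eq_of_sq
  rw [mul_pow, nn_sq, ← lintegral_mul_const _ (by fun_prop)]
  congr 1; ext x; ring

lemma n2_DD_le {H : ℝ → ℝ≥0∞} (hH : Measurable H) :
    n2 nu (fun p => DD p.2 * H p.1) ≤ 2 * nn volume H := by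
  unfold n2
  have h2 : nn nu DD ≤ 2 := by
    refine le_trans ?_ nn_DD
    unfold nn
    gcongr
    exact Measure.restrict_le_self
  simp only
  calc _ = nn volume (fun x => H x * nn nu DD) := by
        congr 1; ext x
        rw [nn_const_mul nu measurable_DD, mul_comm]
    _ = nn volume H * nn nu DD := nn_const_mul _ hH _
    _ ≤ _ := by rw [mul_comm]; gcongr

lemma sq_ofReal_sqrt {I : ℝ} (h : 0 ≤ I) : ENNReal.ofReal √I ^ 2 = ENNReal.ofReal I := by
  rw [← ENNReal.ofReal_pow (Real.sqrt_nonneg _), Real.sq_sqrt h]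

lemma wgt_nonneg (ε t τ s ξ y : ℝ) : 0 ≤ wgt ε t τ s ξ y := by rw [wgt_eq]; positivity

lemma n2_eq {ε t τ s : ℝ} {m : ℝ → ℝ} {W : ℝ → ℝ → ℂ} {u : ℝ × ℝ → ℝ≥0∞} (hm : ∀ ξ, 0 ≤ m ξ)
    (hf : wFinite ε t τ s m W)
    (hu : ∀ᵐ p ∂((volume : Measure ℝ).prod nu),
      u p ^ 2 = ENNReal.ofReal (m p.1 * ‖W p.1 p.2‖ ^ 2 * wgt ε t τ s p.1 p.2)) :
    n2 nu u = ENNReal.ofReal (wNorm ε t τ s m W) := by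
  have h0 : ∀ p : ℝ × ℝ, 0 ≤ m p.1 * ‖W p.1 p.2‖ ^ 2 * wgt ε t τ s p.1 p.2 := fun p =>
    mul_nonneg (mul_nonneg (hm _) (sq_nonneg _)) (wgt_nonneg _ _ _ _ _ _)
  unfold wNorm
  apply nn_eq_of_sq
  rw [sq_ofReal_sqrt (integral_nonneg fun ξ => integral_nonneg fun y => h0 (ξ, y))]
  have hi := integral_prod _ hf
  simp only at hi
  rw [← hi, ofReal_integral_eq_lintegral_ofReal hf (Eventually.of_forall h0),
    lintegral_prod _ hf.aestronglyMeasurable.aemeasurable.ennreal_ofReal]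
  refine lintegral_congr_ae ?_
  filter_upwards [Measure.ae_ae_of_ae_prod hu] with x hx
  rw [nn_sq]
  exact lintegral_congr_ae hx

lemma aN_eq {τ s : ℝ} {m : ℝ → ℝ} {A : ℝ → ℂ} {u : ℝ → ℝ≥0∞} (hm : ∀ ξ, 0 ≤ m ξ)
    (hf : aFinite τ s m A)
    (hu : ∀ᵐ p, u p ^ 2 = ENNReal.ofReal (m p * ‖A p‖ ^ 2 * aWgt τ s p)) :
    nn volume u = ENNReal.ofReal (aNorm τ s m A) := by
  have h0 : ∀ p : ℝ, 0 ≤ m p * ‖A p‖ ^ 2 * aWgt τ s p := fun p =>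
    mul_nonneg (mul_nonneg (hm _) (sq_nonneg _)) (by
      have := brak_pos p
      unfold aWgt; positivity)
  unfold aNorm
  apply nn_eq_of_sq
  rw [sq_ofReal_sqrt (integral_nonneg fun ξ => h0 ξ),
    ofReal_integral_eq_lintegral_ofReal hf (Eventually.of_forall h0)]
  exact lintegral_congr_ae hu

lemma aem_of_sq {α : Type*} [MeasurableSpace α] {μ : Measure α} {f F : α → ℝ}
    (h0 : ∀ x, 0 ≤ f x) (h : Integrable F μ) (hF : ∀ x, f x ^ 2 = F x) :
    AEMeasurable (fun x => ENNReal.ofReal (f x)) μ := by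
  have : (fun x => ENNReal.ofReal (f x)) = fun x => ENNReal.ofReal (√ (F x)) := by
    ext x; rw [← hF, Real.sqrt_sq (h0 x)]
  rw [this]
  exact h.aestronglyMeasurable.aemeasurable.sqrt.ennreal_ofReal

lemma I3_eq {f : ℝ → ℝ → ℝ → ℝ≥0∞} (hf : Measurable fun p : ℝ × ℝ × ℝ => f p.1 p.2.1 p.2.2) :
    ∫⁻ x, (∫⁻ y, (∫⁻ z, f x y z) ∂nu) =
      ∫⁻ p : ℝ × ℝ × ℝ, f p.1 p.2.1 p.2.2 ∂((volume : Measure ℝ).prod (nu.prod volume)) := by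
  rw [lintegral_prod _ hf.aemeasurable]
  congr 1; ext x
  rw [lintegral_prod _ (by fun_prop)]

lemma I3_add4 {f1 f2 f3 f4 : ℝ → ℝ → ℝ → ℝ≥0∞} (K : ℝ≥0∞)
    (h1 : Measurable fun p : ℝ × ℝ × ℝ => f1 p.1 p.2.1 p.2.2)
    (h2 : Measurable fun p : ℝ × ℝ × ℝ => f2 p.1 p.2.1 p.2.2)
    (h3 : Measurable fun p : ℝ × ℝ × ℝ => f3 p.1 p.2.1 p.2.2)
    (h4 : Measurable fun p : ℝ × ℝ × ℝ => f4 p.1 p.2.1 p.2.2) :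
    ∫⁻ x, (∫⁻ y, (∫⁻ z, K * (f1 x y z + f2 x y z + f3 x y z + f4 x y z)) ∂nu) =
      K * ((∫⁻ x, (∫⁻ y, (∫⁻ z, f1 x y z) ∂nu)) + (∫⁻ x, (∫⁻ y, (∫⁻ z, f2 x y z) ∂nu)) +
        (∫⁻ x, (∫⁻ y, (∫⁻ z, f3 x y z) ∂nu)) + (∫⁻ x, (∫⁻ y, (∫⁻ z, f4 x y z) ∂nu))) := by
  rw [I3_eq h1, I3_eq h2, I3_eq h3, I3_eq h4,
    I3_eq (f := fun x y z => K * (f1 x y z + f2 x y z + f3 x y z + f4 x y z)) (by fun_prop),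
    lintegral_const_mul _ (by fun_prop), lintegral_add_left (by fun_prop),
    lintegral_add_left (by fun_prop), lintegral_add_left (by fun_prop)]

lemma conv {K g1 g2 q a1 h2 d1 d2 sb g3 a2 b H : ℝ} (hK : 0 ≤ K) (hg1 : 0 ≤ g1) (hg2 : 0 ≤ g2)
    (hq : 0 ≤ q) (ha1 : 0 ≤ a1) (hh2 : 0 ≤ h2) (hd1 : 0 ≤ d1) (hd2 : 0 ≤ d2) (hsb : 0 ≤ sb)
    (hg3 : 0 ≤ g3) (ha2 : 0 ≤ a2) (hb : 0 ≤ b) (hH : 0 ≤ H) :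
    ENNReal.ofReal (K * (g1 * g2 * (q * a1) * (d1 + d2) + g1 * h2 * a1 * (d1 + d2) +
      (sb * g1) * (q * g3) * a2 * (d2 + d1) + g1 * (b * H) * a1 * (d1 + d2))) =
    ENNReal.ofReal K * (ENNReal.ofReal g1 * ENNReal.ofReal g2 *
      (ENNReal.ofReal q * ENNReal.ofReal a1) * (ENNReal.ofReal d1 + ENNReal.ofReal d2) +
      ENNReal.ofReal g1 * ENNReal.ofReal h2 * ENNReal.ofReal a1 *
        (ENNReal.ofReal d1 + ENNReal.ofReal d2) +
      (ENNReal.ofReal sb * ENNReal.ofReal g1) * (ENNReal.ofReal q * ENNReal.ofReal g3) *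
        ENNReal.ofReal a2 * (ENNReal.ofReal d2 + ENNReal.ofReal d1) +
      ENNReal.ofReal g1 * (ENNReal.ofReal b * ENNReal.ofReal H) * ENNReal.ofReal a1 *
        (ENNReal.ofReal d1 + ENNReal.ofReal d2)) := by
  lift K to NNReal using hK
  lift g1 to NNReal using hg1
  lift g2 to NNReal using hg2
  lift q to NNReal using hq
  lift a1 to NNReal using ha1
  lift h2 to NNReal using hh2
  lift d1 to NNReal using hd1
  lift d2 to NNReal using hd2
  lift sb to NNReal using hsb
  lift g3 to NNReal using hg3
  lift a2 to NNReal using ha2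
  lift b to NNReal using hb
  lift H to NNReal using hH
  simp only [← NNReal.coe_mul, ← NNReal.coe_add, ENNReal.ofReal_coe_nnreal, ENNReal.coe_mul,
    ENNReal.coe_add]

lemma Iy_bd {r ε t τ : ℝ} {w : ℝ → ℝ → ℂ} (hε : 0 < ε) (ht : 0 ≤ t) (hte : t ≤ ε) (η y : ℝ)
    (hy : 0 < y) {h' : ℝ → ℝ≥0∞} (hm : Measurable h')
    (hh : ∀ᵐ z ∂nu, h' z = ENNReal.ofReal (hR ε t τ r w η z)) (hfin : nn nu h' ≠ ∞) :
    Real.exp (τ * |η|) * brak η ^ (r + 1 / 2) * ‖Iy (w η) y‖ ≤ √y * (nn nu h').toReal := by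
  have p1 := brak_pos η
  set c := Real.exp (τ * |η|) * brak η ^ (r + 1 / 2) with hc
  have hc0 : 0 ≤ c := by positivity
  have hsub : (volume : Measure ℝ).restrict (Ioc 0 y) ≤ nu :=
    Measure.restrict_mono Ioc_subset_Ioi_self le_rfl
  have hh' : ∀ᵐ z ∂(volume.restrict (Ioc 0 y)), h' z = ENNReal.ofReal (hR ε t τ r w η z) :=
    ae_mono hsub hh
  have h1 : ENNReal.ofReal (c * ‖Iy (w η) y‖) ≤ ENNReal.ofReal (√y * (nn nu h').toReal) := by
    rw [ENNReal.ofReal_mul hc0, ENNReal.ofReal_mul (Real.sqrt_nonneg _),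
      ENNReal.ofReal_toReal hfin, ofReal_norm]
    unfold Iy
    rw [intervalIntegral.integral_of_le hy.le]
    calc _ ≤ ENNReal.ofReal c * ∫⁻ z in Ioc 0 y, ‖w η z‖ₑ := by
          gcongr; exact enorm_integral_le_lintegral_enorm _
      _ = ∫⁻ z in Ioc 0 y, ENNReal.ofReal c * ‖w η z‖ₑ :=
          (lintegral_const_mul' _ _ ENNReal.ofReal_ne_top).symm
      _ ≤ ∫⁻ z in Ioc 0 y, (fun _ => 1) z * h' z := by
          refine lintegral_mono_ae ?_
          filter_upwards [hh'] with z hz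
          rw [one_mul, hz, ← ofReal_norm, ← ENNReal.ofReal_mul hc0]
          apply ENNReal.ofReal_le_ofReal
          unfold hR
          rw [mul_assoc (rho ε t z), ← hc, mul_assoc (rho ε t z)]
          exact le_mul_of_one_le_left (by positivity) (one_le_rho hε ht hte z)
      _ ≤ nn (volume.restrict (Ioc 0 y)) (fun _ => 1) * nn (volume.restrict (Ioc 0 y)) h' :=
          nn_CS _ (by fun_prop) (by fun_prop)
      _ ≤ _ := by
          gcongr
          · apply le_of_eq
            apply nn_eq_of_sq
            rw [sq_ofReal_sqrt hy.le]
            simp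
          · unfold nn
            gcongr
  exact (ENNReal.ofReal_le_ofReal_iff (by positivity)).1 h1

lemma main_lint {r ε t τ : ℝ} {χ : ℝ → ℝ} {w : ℝ → ℝ → ℂ} {A : ℝ → ℂ}
    (hr : 2 < r) (hε : 0 < ε) (ht : 0 ≤ t) (hte : t ≤ ε) (hτ : 0 < τ)
    (hχ : ∀ y, 0 ≤ χ y) (hχ1 : ∀ y, χ y ≤ 1) (hχ0 : ∀ y : ℝ, y ≤ 1 → χ y = 0)
    (f1 : wFinite ε t τ (r - 1 / 2) (fun _ => 1) (fun ξ y => ((χ y : ℝ) : ℂ) * deriv (w ξ) y))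
    (f2 : wFinite ε t τ (r - 1 / 2) (fun ξ => |ξ|) (fun ξ y => ((χ y : ℝ) : ℂ) * deriv (w ξ) y))
    (f3 : wFinite ε t τ (r - 1 / 2) brak (fun ξ y => ((χ y : ℝ) : ℂ) * deriv (w ξ) y))
    (f4 : wFinite ε t τ r brak w)
    (f5 : aFinite τ r (fun ξ => |ξ|) A)
    (f6 : aFinite τ r (fun _ => 1) A) :
    ∫⁻ ξ, (∫⁻ y, (∫⁻ η, ENNReal.ofReal (
      ‖(deriv (w η) y * ((ξ - η : ℝ) : ℂ) * A (ξ - η) * ((theta ε t (ξ - η) y : ℝ) : ℂ)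
      + w η y * ((ξ - η : ℝ) : ℂ) * A (ξ - η) * ((deriv (theta ε t (ξ - η)) y : ℝ) : ℂ)
      + A η * ((theta ε t η y : ℝ) : ℂ) * ((ξ - η : ℝ) : ℂ) * deriv (w (ξ - η)) y
      - (η : ℂ) * Iy (w η) y * A (ξ - η) *
          ((deriv (deriv (theta ε t (ξ - η))) y : ℝ) : ℂ))‖ * ‖deriv (w ξ) y‖ *
        (χ y ^ 2 * wgt ε t τ (r - 1 / 2) ξ y))) ∂nu) ≤
    ENNReal.ofReal (12 * KC r * ((wNorm ε t τ (r - 1 / 2) (fun _ => 1)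
                (fun ξ y => ((χ y : ℝ) : ℂ) * deriv (w ξ) y)) ^ 2 *
              aNorm τ r (fun ξ => |ξ|) A
            + wNorm ε t τ (r - 1 / 2) (fun _ => 1)
                (fun ξ y => ((χ y : ℝ) : ℂ) * deriv (w ξ) y) *
              wNorm ε t τ r brak w * aNorm τ r (fun _ => 1) A
            + wNorm ε t τ (r - 1 / 2) (fun ξ => |ξ|)
                (fun ξ y => ((χ y : ℝ) : ℂ) * deriv (w ξ) y) *
              wNorm ε t τ (r - 1 / 2) brak
                (fun ξ y => ((χ y : ℝ) : ℂ) * deriv (w ξ) y) *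
              aNorm τ r (fun _ => 1) A)) := by
  have hbm := measurable_brak
  have hDm := measurable_DD
  have hr0 : ∀ y, 0 < rho ε t y := fun y => Real.exp_pos _
  have hg0 : ∀ p : ℝ × ℝ, 0 ≤ gR ε t τ (r - 1 / 2) χ w p.1 p.2 := fun p => by
    have := brak_pos p.1
    have := hχ p.2
    have := hr0 p.2
    unfold gR; positivity
  have hh0 : ∀ p : ℝ × ℝ, 0 ≤ hR ε t τ r w p.1 p.2 := fun p => by
    have := brak_pos p.1
    have := hr0 p.2
    unfold hR; positivity
  have ha0 : ∀ p : ℝ, 0 ≤ aR τ r A p := fun p => by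
    have := brak_pos p
    unfold aR; positivity
  have mg := aem_of_sq hg0 f1 (fun p => by rw [gR_sq]; ring)
  have mh := aem_of_sq hh0 f4 (fun p => by rw [hR_sq])
  have ma := aem_of_sq ha0 f6 (fun p => by rw [aR_sq]; ring)
  obtain ⟨g', hg'm, hg'⟩ := mg
  obtain ⟨h', hh'm, hh'⟩ := mh
  obtain ⟨a', ha'm, ha'⟩ := ma
  -- norms
  have Ng : n2 nu g' = ENNReal.ofReal (wNorm ε t τ (r - 1 / 2) (fun _ => 1)
      (fun ξ y => ((χ y : ℝ) : ℂ) * deriv (w ξ) y)) := by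
    refine n2_eq (fun _ => zero_le_one) f1 ?_
    filter_upwards [hg'] with p hp
    rw [← hp, ← ENNReal.ofReal_pow (hg0 p), gR_sq]
    congr 1; ring
  have Ng1 : n2 nu (fun p => ENNReal.ofReal (√(brak p.1)) * g' p) =
      ENNReal.ofReal (wNorm ε t τ (r - 1 / 2) brak
      (fun ξ y => ((χ y : ℝ) : ℂ) * deriv (w ξ) y)) := by
    refine n2_eq (fun ξ => (brak_pos ξ).le) f3 ?_
    filter_upwards [hg'] with p hp
    rw [← hp, mul_pow, sq_ofReal_sqrt (brak_pos _).le, ← ENNReal.ofReal_pow (hg0 p), gR_sq,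
      ← ENNReal.ofReal_mul (brak_pos _).le]
    congr 1; ring
  have Ng2 : n2 nu (fun p => ENNReal.ofReal (√|p.1|) * g' p) =
      ENNReal.ofReal (wNorm ε t τ (r - 1 / 2) (fun ξ => |ξ|)
      (fun ξ y => ((χ y : ℝ) : ℂ) * deriv (w ξ) y)) := by
    refine n2_eq (fun ξ => abs_nonneg ξ) f2 ?_
    filter_upwards [hg'] with p hp
    rw [← hp, mul_pow, sq_ofReal_sqrt (abs_nonneg _), ← ENNReal.ofReal_pow (hg0 p), gR_sq,
      ← ENNReal.ofReal_mul (abs_nonneg _)]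
    congr 1; ring
  have Nh : n2 nu h' = ENNReal.ofReal (wNorm ε t τ r brak w) := by
    refine n2_eq (fun ξ => (brak_pos ξ).le) f4 ?_
    filter_upwards [hh'] with p hp
    rw [← hp, ← ENNReal.ofReal_pow (hh0 p), hR_sq]
  have Na : nn volume a' = ENNReal.ofReal (aNorm τ r (fun _ => 1) A) := by
    refine aN_eq (fun _ => zero_le_one) f6 ?_
    filter_upwards [ha'] with p hp
    rw [← hp, ← ENNReal.ofReal_pow (ha0 p), aR_sq]
    congr 1; ring
  have Na1 : nn volume (fun z => ENNReal.ofReal (√|z|) * a' z) =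
      ENNReal.ofReal (aNorm τ r (fun ξ => |ξ|) A) := by
    refine aN_eq (fun ξ => abs_nonneg ξ) f5 ?_
    filter_upwards [ha'] with p hp
    rw [← hp, mul_pow, sq_ofReal_sqrt (abs_nonneg _), ← ENNReal.ofReal_pow (ha0 p), aR_sq,
      ← ENNReal.ofReal_mul (abs_nonneg _)]
    congr 1; ring
  -- the L2 norm in y
  set H' : ℝ → ℝ≥0∞ := fun x => nn nu (fun y => h' (x, y)) with hH'
  have hH'm : Measurable H' := meas_nn hh'm
  have NH : nn volume H' = n2 nu h' := rfl
  have Hfin : ∀ᵐ η, H' η ≠ ∞ := by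
    have h1 : ∫⁻ x, H' x ^ 2 ≠ ∞ := by
      rw [← nn_sq, NH, Nh]; exact ENNReal.pow_ne_top ENNReal.ofReal_ne_top
    filter_upwards [ae_lt_top (by fun_prop) h1] with x hx hx'
    rw [hx'] at hx; simp at hx
  have hH : ∀ᵐ η, ∀ y, 0 < y →
      Real.exp (τ * |η|) * brak η ^ (r + 1 / 2) * ‖Iy (w η) y‖ ≤ √y * (H' η).toReal := by
    filter_upwards [Hfin, Measure.ae_ae_of_ae_prod hh'] with η h1 h2 y hy
    exact Iy_bd hε ht hte η y hy (h' := fun y => h' (η, y)) (by fun_prop)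
      (by filter_upwards [h2] with z hz using hz.symm) h1
  have Gs : ∀ᵐ y ∂nu, ∀ᵐ η, g' (η, y) = ENNReal.ofReal (gR ε t τ (r - 1 / 2) χ w η y) ∧
      h' (η, y) = ENNReal.ofReal (hR ε t τ r w η y) := by
    apply Measure.ae_ae_of_ae_prod (μ := nu) (ν := volume)
      (p := fun q : ℝ × ℝ => g' (q.2, q.1) = ENNReal.ofReal (gR ε t τ (r - 1 / 2) χ w q.2 q.1) ∧
      h' (q.2, q.1) = ENNReal.ofReal (hR ε t τ r w q.2 q.1))
    have := (Measure.measurePreserving_swap (μ := nu)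
      (ν := (volume : Measure ℝ))).quasiMeasurePreserving.ae (hg'.and hh')
    filter_upwards [this] with q hq
    exact ⟨hq.1.symm, hq.2.symm⟩
  have hshift : ∀ (ξ : ℝ) {p : ℝ → Prop}, (∀ᵐ η, p η) → ∀ᵐ η, p (ξ - η) := fun ξ p hp =>
    (Measure.measurePreserving_sub_left volume ξ).quasiMeasurePreserving.ae hp
  have key : ∀ᵐ ξ, ∀ᵐ y ∂nu, ∀ᵐ η, ENNReal.ofReal (
      ‖(deriv (w η) y * ((ξ - η : ℝ) : ℂ) * A (ξ - η) * ((theta ε t (ξ - η) y : ℝ) : ℂ)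
      + w η y * ((ξ - η : ℝ) : ℂ) * A (ξ - η) * ((deriv (theta ε t (ξ - η)) y : ℝ) : ℂ)
      + A η * ((theta ε t η y : ℝ) : ℂ) * ((ξ - η : ℝ) : ℂ) * deriv (w (ξ - η)) y
      - (η : ℂ) * Iy (w η) y * A (ξ - η) *
          ((deriv (deriv (theta ε t (ξ - η))) y : ℝ) : ℂ))‖ * ‖deriv (w ξ) y‖ *
        (χ y ^ 2 * wgt ε t τ (r - 1 / 2) ξ y)) ≤
      ENNReal.ofReal (KC r) * (
        g' (ξ, y) * g' (η, y) * (ENNReal.ofReal (√|ξ - η|) * a' (ξ - η)) * (DD (ξ - η) + DD η)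
        + g' (ξ, y) * h' (η, y) * a' (ξ - η) * (DD (ξ - η) + DD η)
        + (ENNReal.ofReal (√(brak ξ)) * g' (ξ, y)) *
            (ENNReal.ofReal (√|ξ - η|) * g' (ξ - η, y)) * a' η * (DD η + DD (ξ - η))
        + g' (ξ, y) * (DD y * H' η) * a' (ξ - η) * (DD (ξ - η) + DD η)) := by
    filter_upwards [Measure.ae_ae_of_ae_prod hg'] with ξ hξ
    filter_upwards [hξ, Gs, ae_restrict_mem measurableSet_Ioi] with y hy1 hy2 hy0
    filter_upwards [hy2, hshift ξ hy2, ha', hshift ξ ha', hH, Hfin] with η e1 e2 e3 e4 e5 e6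
    rw [e1.1, e1.2, e2.1, ← e3, ← e4, ← hy1, ← ENNReal.ofReal_toReal e6]
    unfold DD
    rw [← conv (KC_pos r).le (hg0 (ξ, y)) (hg0 (η, y)) (Real.sqrt_nonneg _) (ha0 _) (hh0 (η, y))
      (inv_pos.2 (brak_pos _)).le (inv_pos.2 (brak_pos _)).le (Real.sqrt_nonneg _)
      (hg0 (ξ - η, y)) (ha0 _) (inv_pos.2 (brak_pos _)).le ENNReal.toReal_nonneg]
    apply ENNReal.ofReal_le_ofReal
    exact pw hr hε ht hte hτ hχ hχ1 hχ0 ξ η y _ ENNReal.toReal_nonneg (e5 y hy0)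
  refine (lintegral_mono_ae (key.mono fun ξ hξ => lintegral_mono_ae (hξ.mono fun y hy =>
    lintegral_mono_ae hy))).trans ?_
  rw [I3_add4 (f1 := fun ξ y η => g' (ξ, y) * g' (η, y) *
          (ENNReal.ofReal (√|ξ - η|) * a' (ξ - η)) * (DD (ξ - η) + DD η))
    (f2 := fun ξ y η => g' (ξ, y) * h' (η, y) * a' (ξ - η) * (DD (ξ - η) + DD η))
    (f3 := fun ξ y η => (ENNReal.ofReal (√(brak ξ)) * g' (ξ, y)) *
            (ENNReal.ofReal (√|ξ - η|) * g' (ξ - η, y)) * a' η * (DD η + DD (ξ - η)))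
    (f4 := fun ξ y η => g' (ξ, y) * (DD y * H' η) * a' (ξ - η) * (DD (ξ - η) + DD η))
    _ (by fun_prop) (by fun_prop) (by fun_prop) (by fun_prop)]
  have B1 := L3 (ν := nu) hg'm hg'm (b := fun z => ENNReal.ofReal (√|z|) * a' z) (by fun_prop)
  have B2 := L3 (ν := nu) hg'm hh'm ha'm
  have B3 := L3' (ν := nu) (u := fun p => ENNReal.ofReal (√(brak p.1)) * g' p)
    (v := fun p => ENNReal.ofReal (√|p.1|) * g' p) (by fun_prop) (by fun_prop) ha'm
  have B4 := L3 (ν := nu) hg'm (v := fun p => DD p.2 * H' p.1) (by fun_prop) ha'm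
  have B4' := n2_DD_le hH'm
  rw [NH] at B4'
  refine (mul_le_mul_right (add_le_add (add_le_add (add_le_add B1 B2) B3)
    (B4.trans (mul_le_mul_right (mul_le_mul_left (mul_le_mul_right B4' _) _) _))) _).trans ?_
  rw [Ng, Ng1, Ng2, Nh, Na, Na1]
  have hK := KC_pos r
  generalize hx1 : wNorm ε t τ (r - 1 / 2) (fun _ => 1)
      (fun ξ y => ((χ y : ℝ) : ℂ) * deriv (w ξ) y) = x1
  generalize hx2 : wNorm ε t τ (r - 1 / 2) brak
      (fun ξ y => ((χ y : ℝ) : ℂ) * deriv (w ξ) y) = x2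
  generalize hx3 : wNorm ε t τ (r - 1 / 2) (fun ξ => |ξ|)
      (fun ξ y => ((χ y : ℝ) : ℂ) * deriv (w ξ) y) = x3
  generalize hx4 : wNorm ε t τ r brak w = x4
  generalize hx5 : aNorm τ r (fun _ => 1) A = x5
  generalize hx6 : aNorm τ r (fun ξ => |ξ|) A = x6
  have k1 : 0 ≤ x1 := hx1 ▸ Real.sqrt_nonneg _
  have k2 : 0 ≤ x2 := hx2 ▸ Real.sqrt_nonneg _
  have k3 : 0 ≤ x3 := hx3 ▸ Real.sqrt_nonneg _
  have k4 : 0 ≤ x4 := hx4 ▸ Real.sqrt_nonneg _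
  have k5 : 0 ≤ x5 := hx5 ▸ Real.sqrt_nonneg _
  have k6 : 0 ≤ x6 := hx6 ▸ Real.sqrt_nonneg _
  clear hx1 hx2 hx3 hx4 hx5 hx6 B1 B2 B3 B4 B4' key
  generalize KC r = K at hK ⊢
  lift K to NNReal using hK.le
  lift x1 to NNReal using k1
  lift x2 to NNReal using k2
  lift x3 to NNReal using k3
  lift x4 to NNReal using k4
  lift x5 to NNReal using k5
  lift x6 to NNReal using k6
  rw [show (12 : ℝ) = ((12 : NNReal) : ℝ) by norm_num]
  simp only [← NNReal.coe_mul, ← NNReal.coe_add, ← NNReal.coe_pow, ENNReal.ofReal_coe_nnreal]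
  rw [show (4 : ℝ≥0∞) = ((4 : NNReal) : ℝ≥0∞) by norm_num,
    show (2 : ℝ≥0∞) = ((2 : NNReal) : ℝ≥0∞) by norm_num]
  simp only [← ENNReal.coe_mul, ← ENNReal.coe_add, ENNReal.coe_le_coe]
  rw [← NNReal.coe_le_coe]
  push_cast
  have q1 : (0 : ℝ) ≤ K * (x1 * x1 * x6) := by positivity
  have q2 : (0 : ℝ) ≤ K * (x2 * x3 * x5) := by positivity
  nlinarith [q1, q2]
/-- **Bound (3.18b) of the paper** on
`T_{∂yℒ} = ∫∫ ∂_yℒ_ξ conj(∂_y w̄_ξ) χ² ρ² e^{2τ|ξ|}⟨ξ⟩^{2r−1} dy dξ`. -/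
theorem TdyL_bound :
    ∀ r : ℝ, 2 < r →
    ∃ C : ℝ, 0 < C ∧
    ∀ (ε t τ : ℝ), 0 < ε → ε ≤ 1 → 0 ≤ t → t ≤ ε → 0 < τ →
    ∀ χ : ℝ → ℝ, ContDiff ℝ (⊤ : ℕ∞) χ →
      (∀ y : ℝ, 0 ≤ χ y ∧ χ y ≤ 1) →
      (∀ y : ℝ, y ≤ 1 → χ y = 0) →
      (∀ y : ℝ, 6 ≤ y → χ y = 1) →
      (∀ y : ℝ, 0 ≤ deriv χ y ∧ deriv χ y ≤ 1) →
    ∀ (w : ℝ → ℝ → ℂ) (A : ℝ → ℂ),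
      (∀ ξ : ℝ, ContDiffOn ℝ 2 (w ξ) (Ici 0)) →
      (∀ ξ : ℝ, w ξ 0 = 0) →
      wFinite ε t τ (r - 1 / 2) (fun _ => 1) (fun ξ y => ((χ y : ℝ) : ℂ) * deriv (w ξ) y) →
      wFinite ε t τ (r - 1 / 2) (fun ξ => |ξ|) (fun ξ y => ((χ y : ℝ) : ℂ) * deriv (w ξ) y) →
      wFinite ε t τ (r - 1 / 2) brak (fun ξ y => ((χ y : ℝ) : ℂ) * deriv (w ξ) y) →
      wFinite ε t τ r brak w →
      aFinite τ r (fun ξ => |ξ|) A →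
      aFinite τ r (fun _ => 1) A →
      Integrable (fun q : ℝ × ℝ × ℝ =>
        (deriv (w q.2.1) q.2.2 * ((q.1 - q.2.1 : ℝ) : ℂ) * A (q.1 - q.2.1) *
              ((theta ε t (q.1 - q.2.1) q.2.2 : ℝ) : ℂ)
            + w q.2.1 q.2.2 * ((q.1 - q.2.1 : ℝ) : ℂ) * A (q.1 - q.2.1) *
              ((deriv (theta ε t (q.1 - q.2.1)) q.2.2 : ℝ) : ℂ)
            + A q.2.1 * ((theta ε t q.2.1 q.2.2 : ℝ) : ℂ) * ((q.1 - q.2.1 : ℝ) : ℂ) *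
              deriv (w (q.1 - q.2.1)) q.2.2
            - (q.2.1 : ℂ) * Iy (w q.2.1) q.2.2 * A (q.1 - q.2.1) *
              ((deriv (deriv (theta ε t (q.1 - q.2.1))) q.2.2 : ℝ) : ℂ)) *
          (starRingEnd ℂ) (deriv (w q.1) q.2.2) *
          (((χ q.2.2) ^ 2 * wgt ε t τ (r - 1 / 2) q.1 q.2.2 : ℝ) : ℂ))
        ((volume : Measure ℝ).prod
          ((volume : Measure ℝ).prod ((volume : Measure ℝ).restrict (Ioi 0)))) →
      ‖∫ ξ : ℝ, ∫ y in Ioi (0 : ℝ),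
          dyLcal ε t w A ξ y * (starRingEnd ℂ) (deriv (w ξ) y) *
            (((χ y) ^ 2 * wgt ε t τ (r - 1 / 2) ξ y : ℝ) : ℂ)‖
        ≤ C * ((wNorm ε t τ (r - 1 / 2) (fun _ => 1)
                (fun ξ y => ((χ y : ℝ) : ℂ) * deriv (w ξ) y)) ^ 2 *
              aNorm τ r (fun ξ => |ξ|) A
            + wNorm ε t τ (r - 1 / 2) (fun _ => 1)
                (fun ξ y => ((χ y : ℝ) : ℂ) * deriv (w ξ) y) *
              wNorm ε t τ r brak w * aNorm τ r (fun _ => 1) A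
            + wNorm ε t τ (r - 1 / 2) (fun ξ => |ξ|)
                (fun ξ y => ((χ y : ℝ) : ℂ) * deriv (w ξ) y) *
              wNorm ε t τ (r - 1 / 2) brak
                (fun ξ y => ((χ y : ℝ) : ℂ) * deriv (w ξ) y) *
              aNorm τ r (fun _ => 1) A) := by
  intro r hr
  refine ⟨12 * KC r, by have := KC_pos r; positivity, ?_⟩
  intro ε t τ hε _ ht hte hτ χ _ hχ hχ0 _ _ w A _ _ f1 f2 f3 f4 f5 f6 _
  have hM := main_lint hr hε ht hte hτ (fun y => (hχ y).1) (fun y => (hχ y).2) hχ0 f1 f2 f3 f4 f5 f6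
  have hK := KC_pos r
  refine (ENNReal.ofReal_le_ofReal_iff ?_).1 (le_trans ?_ hM)
  · have n1 : ∀ s m W, 0 ≤ wNorm ε t τ s m W := fun s m W => Real.sqrt_nonneg _
    have n2 : ∀ m, 0 ≤ aNorm τ r m A := fun m => Real.sqrt_nonneg _
    refine mul_nonneg (by positivity) (add_nonneg (add_nonneg ?_ ?_) ?_)
    · exact mul_nonneg (sq_nonneg _) (n2 _)
    · exact mul_nonneg (mul_nonneg (n1 _ _ _) (n1 _ _ _)) (n2 _)
    · exact mul_nonneg (mul_nonneg (n1 _ _ _) (n1 _ _ _)) (n2 _)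
  rw [ofReal_norm]
  refine (enorm_integral_le_lintegral_enorm _).trans (lintegral_mono fun ξ => ?_)
  refine (enorm_integral_le_lintegral_enorm _).trans (lintegral_mono fun y => ?_)
  have hw : 0 ≤ χ y ^ 2 * wgt ε t τ (r - 1 / 2) ξ y :=
    mul_nonneg (sq_nonneg _) (wgt_nonneg _ _ _ _ _ _)
  have e1 : ‖(starRingEnd ℂ) (deriv (w ξ) y)‖ₑ = ENNReal.ofReal ‖deriv (w ξ) y‖ := by
    rw [← ofReal_norm, RCLike.norm_conj]
  have e2 : ‖(((χ y) ^ 2 * wgt ε t τ (r - 1 / 2) ξ y : ℝ) : ℂ)‖ₑ =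
      ENNReal.ofReal (χ y ^ 2 * wgt ε t τ (r - 1 / 2) ξ y) := by
    rw [← ofReal_norm, Complex.norm_real, Real.norm_of_nonneg hw]
  have e3 : ‖Complex.I‖ₑ = 1 := by rw [← ofReal_norm, Complex.norm_I, ENNReal.ofReal_one]
  rw [enorm_mul, enorm_mul, e1, e2, mul_assoc, ← ENNReal.ofReal_mul (norm_nonneg _)]
  unfold dyLcal
  rw [enorm_mul, e3, one_mul]
  refine (mul_le_mul_left (enorm_integral_le_lintegral_enorm _) _).trans (le_of_eq ?_)
  rw [← lintegral_mul_const' _ _ ENNReal.ofReal_ne_top]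
  refine lintegral_congr fun η => ?_
  rw [← ofReal_norm, ← ENNReal.ofReal_mul (norm_nonneg _)]
  congr 1
  exact (mul_assoc _ _ _).symm
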